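/- Kernel-average lower bound for a Gaussian density: let m ∈ ℝ, σ > 0, and let q(x) = (1/σ) φ((x − m)/σ) be the N(m, σ²) density. Let x₀ ∈ ℝ and h > 0 with 2h ≤ σ; set μ = (x₀ − m)/σ, L = h/σ, and m̃ = min{|μ − L|, |μ + L|}. Then (1/h) ∫_{x₀−h}^{x₀+h} q(x) dx ≥ 2 e^{−2} · min{1, 1/(2 L m̃)} · sup_{|c| ≤ 1} q(x₀ + c h), where the factor min{1, 1/(2 L m̃)} is interpreted as 1 when m̃ = 0. -/

import Mathlib

open MeasureTheory Real

/-- The standard normal density `φ(t) = (2π)^{-1/2} exp(−t²/2)`. -/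
noncomputable def stdNormalPDF (t : ℝ) : ℝ :=
  (Real.sqrt (2 * Real.pi))⁻¹ * Real.exp (-t ^ 2 / 2)

/-- The window `[μ₀ - L, μ₀ + L]` contains a subwindow of relative length `F` on which the square
exceeds its infimum over the whole window by at most `4`. -/
lemma exists_subwindow_sq_le {μ₀ L F : ℝ} (hL0 : 0 < L) (hL : 2 * L ≤ 1) (hF0 : 0 ≤ F)
    (hF1 : F ≤ 1) (hF : 2 * L * min |μ₀ - L| |μ₀ + L| * F ≤ 1) :
    ∃ e, -1 ≤ e ∧ e + 2 * F ≤ 1 ∧ ∀ c ∈ Set.Icc e (e + 2 * F), ∀ d ∈ Set.Icc (-1 : ℝ) 1,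
      (μ₀ + c * L) ^ 2 ≤ (μ₀ + d * L) ^ 2 + 4 := by
  rcases le_or_gt L μ₀ with h1 | h1
  · rw [abs_of_nonneg (by linarith), abs_of_nonneg (by linarith), min_eq_left (by linarith)] at hF
    refine ⟨-1, le_rfl, by linarith, fun c hc d hd => ?_⟩
    obtain ⟨hc1, hc2⟩ := hc
    have hs0 : 0 ≤ (c + 1) * L := mul_nonneg (by linarith) hL0.le
    have hs1 : (c + 1) * L ≤ 2 * F * L := mul_le_mul_of_nonneg_right (by linarith) hL0.le
    have hs2 : 2 * F * L ≤ 1 := by nlinarith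
    have hd0 : 0 ≤ (d + 1) * L := mul_nonneg (by linarith [hd.1]) hL0.le
    have ha : 0 ≤ μ₀ - L := by linarith
    have hs3 := mul_le_mul_of_nonneg_left hs1 ha
    have hc' : μ₀ + c * L = (μ₀ - L) + (c + 1) * L := by ring
    have hd' : μ₀ + d * L = (μ₀ - L) + (d + 1) * L := by ring
    rw [hc', hd']
    nlinarith [mul_nonneg ha hd0]
  rcases le_or_gt μ₀ (-L) with h2 | h2
  · rw [abs_of_nonpos (by linarith), abs_of_nonpos (by linarith), min_eq_right (by linarith)] at hF
    refine ⟨1 - 2 * F, by linarith, by linarith, fun c hc d hd => ?_⟩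
    obtain ⟨hc1, hc2⟩ := hc
    have hs0 : 0 ≤ (1 - c) * L := mul_nonneg (by linarith) hL0.le
    have hs1 : (1 - c) * L ≤ 2 * F * L := mul_le_mul_of_nonneg_right (by linarith) hL0.le
    have hs2 : 2 * F * L ≤ 1 := by nlinarith
    have hd0 : 0 ≤ (1 - d) * L := mul_nonneg (by linarith [hd.2]) hL0.le
    have ha : 0 ≤ -(μ₀ + L) := by linarith
    have hs3 := mul_le_mul_of_nonneg_left hs1 ha
    have hc' : μ₀ + c * L = -(-(μ₀ + L) + (1 - c) * L) := by ring
    have hd' : μ₀ + d * L = -(-(μ₀ + L) + (1 - d) * L) := by ring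
    rw [hc', hd']
    nlinarith [mul_nonneg ha hd0]
  · refine ⟨-1, le_rfl, by linarith, fun c hc d _ => ?_⟩
    obtain ⟨hc1, hc2⟩ := hc
    have h3 : |μ₀ + c * L| ≤ 1 := abs_le.2 ⟨by nlinarith, by nlinarith⟩
    have h4 := (sq_le_one_iff_abs_le_one _).2 h3
    nlinarith [sq_nonneg (μ₀ + d * L)]

lemma exp_neg_two_mul_stdNormalPDF_le {s t : ℝ} (h : t ^ 2 ≤ s ^ 2 + 4) :
    Real.exp (-2) * stdNormalPDF s ≤ stdNormalPDF t := by
  unfold stdNormalPDF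
  rw [mul_left_comm, ← Real.exp_add]
  gcongr
  linarith

lemma stdNormalPDF_nonneg (t : ℝ) : 0 ≤ stdNormalPDF t := by
  unfold stdNormalPDF
  positivity

lemma continuous_stdNormalPDF : Continuous stdNormalPDF := by
  unfold stdNormalPDF
  fun_prop

/-- Kernel-average lower bound for a Gaussian density: if
`q(x) = (1/σ)φ((x − m)/σ)` is the `N(m, σ²)` density, `2h ≤ σ`,
`μ₀ = (x₀ − m)/σ`, `L = h/σ`, and `mTilde = min{|μ₀ − L|, |μ₀ + L|}`, then
`(1/h) ∫_{x₀−h}^{x₀+h} q ≥ 2e^{−2} min{1, 1/(2LmTilde)} sup_{|c| ≤ 1} q(x₀ + ch)`,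
where the factor `min{1, 1/(2LmTilde)}` is written as
`if 2LmTilde ≤ 1 then 1 else (2LmTilde)⁻¹`, which agrees with the convention that it
equals `1` when `mTilde = 0`. -/
theorem stmt_17 (m σ : ℝ) (hσ : 0 < σ) (q : ℝ → ℝ)
    (hq : ∀ x, q x = (1 / σ) * stdNormalPDF ((x - m) / σ))
    (x₀ h : ℝ) (hh : 0 < h) (hhσ : 2 * h ≤ σ)
    (μ₀ L mTilde : ℝ) (hμ₀ : μ₀ = (x₀ - m) / σ) (hL : L = h / σ)
    (hmTilde : mTilde = min |μ₀ - L| |μ₀ + L|) :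
    2 * Real.exp (-2) * (if 2 * L * mTilde ≤ 1 then 1 else (2 * L * mTilde)⁻¹) *
        sSup ((fun c => q (x₀ + c * h)) '' Set.Icc (-1 : ℝ) 1) ≤
      (1 / h) * ∫ x in (x₀ - h)..(x₀ + h), q x := by
  have hL0 : 0 < L := hL ▸ div_pos hh hσ
  have hL1 : 2 * L ≤ 1 := by
    rw [hL, ← mul_div_assoc]
    exact (div_le_one hσ).2 hhσ
  have hF : ∃ F : ℝ, (if 2 * L * mTilde ≤ 1 then 1 else (2 * L * mTilde)⁻¹) = F ∧ 0 ≤ F ∧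
      F ≤ 1 ∧ 2 * L * mTilde * F ≤ 1 := by
    refine ⟨_, rfl, ?_⟩
    split_ifs with hc
    · exact ⟨zero_le_one, le_rfl, by simpa using hc⟩
    · have hc' := not_le.1 hc
      exact ⟨inv_nonneg.2 (by linarith), inv_le_one_of_one_le₀ hc'.le,
        (mul_inv_cancel₀ (by linarith)).le⟩
  obtain ⟨F, hFeq, hF0, hF1, hF2⟩ := hF
  rw [hFeq]
  rw [hmTilde] at hF2
  obtain ⟨e, he1, he2, he⟩ := exists_subwindow_sq_le hL0 hL1 hF0 hF1 hF2
  have hqc : Continuous q := by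
    rw [funext hq]
    exact continuous_const.mul (continuous_stdNormalPDF.comp (by fun_prop))
  have hq0 : ∀ x, 0 ≤ q x := fun x => by
    rw [hq]
    exact mul_nonneg (by positivity) (stdNormalPDF_nonneg _)
  have hcoord : ∀ c, (x₀ + c * h - m) / σ = μ₀ + c * L := fun c => by
    rw [hμ₀, hL]
    ring
  have hcomp : ∀ c ∈ Set.Icc e (e + 2 * F),
      Real.exp (-2) * sSup ((fun c => q (x₀ + c * h)) '' Set.Icc (-1 : ℝ) 1) ≤ q (x₀ + c * h) := by
    intro c hc
    rw [← le_div_iff₀' (Real.exp_pos _)]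
    refine csSup_le ((Set.nonempty_Icc.2 (by norm_num)).image _) ?_
    rintro _ ⟨d, hd, rfl⟩
    rw [le_div_iff₀' (Real.exp_pos _)]
    simp only [hq, hcoord]
    rw [mul_left_comm]
    exact mul_le_mul_of_nonneg_left (exp_neg_two_mul_stdNormalPDF_le (he c hc d hd))
      (by positivity)
  set S := sSup ((fun c => q (x₀ + c * h)) '' Set.Icc (-1 : ℝ) 1)
  have huv : x₀ + e * h ≤ x₀ + (e + 2 * F) * h := by nlinarith [mul_nonneg hF0 hh.le]
  have hsub : ∫ _ in (x₀ + e * h)..(x₀ + (e + 2 * F) * h), Real.exp (-2) * S ≤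
      ∫ x in (x₀ + e * h)..(x₀ + (e + 2 * F) * h), q x := by
    refine intervalIntegral.integral_mono_on huv (by simp) (hqc.intervalIntegrable _ _) ?_
    intro x hx
    have hx' : x₀ + (x - x₀) / h * h = x := by
      field_simp
      ring
    rw [← hx']
    refine hcomp _ ⟨?_, ?_⟩
    · rw [le_div_iff₀ hh]
      linarith [hx.1]
    · rw [div_le_iff₀ hh]
      linarith [hx.2]
  have hmono : ∫ x in (x₀ + e * h)..(x₀ + (e + 2 * F) * h), q x ≤
      ∫ x in (x₀ - h)..(x₀ + h), q x :=
    intervalIntegral.integral_mono_interval (by nlinarith) huv (by nlinarith)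
      (Filter.Eventually.of_forall hq0) (hqc.intervalIntegrable _ _)
  rw [intervalIntegral.integral_const, smul_eq_mul] at hsub
  rw [one_div, ← div_eq_inv_mul, le_div_iff₀ hh]
  calc 2 * Real.exp (-2) * F * S * h
      = (x₀ + (e + 2 * F) * h - (x₀ + e * h)) * (Real.exp (-2) * S) := by ring
    _ ≤ _ := hsub.trans hmono
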